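/- arXiv:2404.08370 — 6 statements merged into one kernel-verified Lean document; each statement's English description precedes it below -/
import Mathlib

section
/- Let Ap = b be a linear system over 𝔽₂ with k equations in the variables p_{ij} (i ∈ [m], j ∈ [n]). If Ap = b has a HOLES_n^m-proper solution, then it has a HOLES_n^m-proper solution that assigns the value 1 to at most k of the variables. -/
open Finset

/-- The two-element field. -/
abbrev F2 : Type := ZMod 2

/-- An `F2`-linear form in the variables `V`, given by its coefficients. -/
abbrev LinForm (V : Type) : Type := V → F2

/-- A linear literal: an equation `f = a` where `f` is a linear form and `a ∈ F2`. -/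
abbrev LinLit (V : Type) : Type := LinForm V × F2

/-- A linear clause: a finite disjunction of linear literals. -/
abbrev LinClause (V : Type) : Type := Finset (LinLit V)

/-- A linear system: a finite conjunction of linear equations. -/
abbrev LinSystem (V : Type) : Type := Finset (LinLit V)

/-- A linear CNF formula: a conjunction of linear clauses. -/
abbrev LinCNF (V : Type) : Type := Set (LinClause V)

variable {V : Type}

/-- Evaluation of a linear form at an assignment. -/
def evalForm [Fintype V] (f : LinForm V) (σ : V → F2) : F2 := ∑ v, f v * σ v

/-- The assignment `σ` satisfies the linear equation `l.1 = l.2`. -/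
def LitSat [Fintype V] (σ : V → F2) (l : LinLit V) : Prop := evalForm l.1 σ = l.2

/-- The assignment `σ` satisfies the linear clause `C` (some literal of `C` holds). -/
def ClauseSat [Fintype V] (σ : V → F2) (C : LinClause V) : Prop := ∃ l ∈ C, LitSat σ l

/-- The assignment `σ` is a solution of the linear system `S` (all equations hold). -/
def SysSat [Fintype V] (σ : V → F2) (S : LinSystem V) : Prop := ∀ l ∈ S, LitSat σ l

/-- The assignment `σ` satisfies the linear CNF `φ`. -/
def CNFSat [Fintype V] (σ : V → F2) (φ : LinCNF V) : Prop := ∀ C ∈ φ, ClauseSat σ C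

/-- The linear CNF `φ` is unsatisfiable. -/
def Unsat [Fintype V] (φ : LinCNF V) : Prop := ¬ ∃ σ, CNFSat σ φ

/-- The positive literal `v = 1` for a single variable `v`. -/
def posLit [DecidableEq V] (v : V) : LinLit V := (Pi.single v 1, 1)

/-- The negative literal `v = 0` for a single variable `v`. -/
def negLit [DecidableEq V] (v : V) : LinLit V := (Pi.single v 1, 0)

/-- A solution is `F`-proper if it satisfies every clause of `F`. -/
def FProper [Fintype V] (F : Set (LinClause V)) (σ : V → F2) : Prop := ∀ C ∈ F, ClauseSat σ C

/-- `φ` is `m`-extensible w.r.t. `F`: every linear system with fewer than `m` equations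
that has an `F`-proper solution has, for each clause `C ∈ φ \ F`, an `F`-proper solution
satisfying `C`. -/
def Extensible [Fintype V] (φ : LinCNF V) (F : Set (LinClause V)) (m : ℕ) : Prop :=
  ∀ S : LinSystem V, S.card < m → (∃ σ, SysSat σ S ∧ FProper F σ) →
    ∀ C ∈ φ \ F, ∃ τ, SysSat τ S ∧ FProper F τ ∧ ClauseSat τ C

/-- An assignment to the variables `p_{ij}` is HOLES-proper if it satisfies every hole
axiom, i.e. no hole receives two distinct pigeons. -/
def HolesProper {m n : ℕ} (σ : Fin m × Fin n → F2) : Prop :=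
  ∀ i i' : Fin m, ∀ k : Fin n, i ≠ i' → ¬(σ (i, k) = 1 ∧ σ (i', k) = 1)

/-- The pigeon axiom `P_i = ⋁_{j ∈ [n]} p_{ij}`. -/
def pigeonClause {m n : ℕ} (i : Fin m) : LinClause (Fin m × Fin n) :=
  Finset.univ.image fun j : Fin n => posLit (i, j)

/-- The hole axiom `H_{i i' k} = ¬p_{ik} ∨ ¬p_{i'k}`. -/
def holeClause {m n : ℕ} (i i' : Fin m) (k : Fin n) : LinClause (Fin m × Fin n) :=
  {negLit (i, k), negLit (i', k)}

/-- The pigeonhole principle `PHP_n^m` as a linear CNF. -/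
def PHPCNF (m n : ℕ) : LinCNF (Fin m × Fin n) :=
  {C | ∃ i : Fin m, C = pigeonClause i} ∪
  {C | ∃ (i i' : Fin m) (k : Fin n), i ≠ i' ∧ C = holeClause i i' k}

/-- More vectors than coordinates admit a nontrivial relation; here the
vectors are the columns, indexed by `O`, of the coefficient matrix of a linear system. -/
theorem LinSystem.exists_kernel_of_card_lt {W : Type} [Fintype W] (S : LinSystem W)
    (O : Finset W) (h : S.card < O.card) :
    ∃ c : W → F2, (∀ v ∉ O, c v = 0) ∧ (∃ v ∈ O, c v ≠ 0) ∧ ∀ l ∈ S, evalForm l.1 c = 0 := by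
  classical
  have hdep : ¬ LinearIndependent F2 (fun (v : O) (l : S) => l.1.1 v.1) := by
    intro hli
    have hle := hli.fintype_card_le_finrank
    simp only [Fintype.card_coe, Module.finrank_fintype_fun_eq_card] at hle
    omega
  obtain ⟨g, hg, v, hv⟩ := Fintype.not_linearIndependent_iff.mp hdep
  refine ⟨fun w => if hw : w ∈ O then g ⟨w, hw⟩ else 0, fun w hw => by simp [hw],
    ⟨v.1, v.2, by simpa using hv⟩, fun l hl => ?_⟩
  have hgl := congrFun hg ⟨l, hl⟩
  simp only [Finset.sum_apply, Pi.smul_apply, smul_eq_mul, Pi.zero_apply] at hgl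
  rw [evalForm, ← Finset.sum_subset (Finset.subset_univ O) (fun w _ hw => by simp [hw]),
    ← Finset.sum_coe_sort, ← hgl]
  exact Finset.sum_congr rfl fun w _ => by simp [mul_comm]

/-- A solution of a linear system over `F2` can be shrunk to one whose support is contained in the
original support and has at most as many elements as there are equations. -/
theorem SysSat.exists_sparse {W : Type} [Fintype W] (S : LinSystem W) (σ : W → F2)
    (hσ : SysSat σ S) :
    ∃ τ, SysSat τ S ∧ (∀ v, τ v = 1 → σ v = 1) ∧
      (Finset.univ.filter fun v => τ v = 1).card ≤ S.card := by
  classical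
  induction hN : (Finset.univ.filter fun v => σ v = 1).card using Nat.strong_induction_on
    generalizing σ with
  | _ N ih =>
    by_cases hle : N ≤ S.card
    · exact ⟨σ, hσ, fun _ h => h, hN ▸ hle⟩
    obtain ⟨c, hc, ⟨v, hvO, hv⟩, hker⟩ := LinSystem.exists_kernel_of_card_lt S
      (Finset.univ.filter fun v => σ v = 1) (by omega)
    have hsub : ∀ w, (σ + c) w = 1 → σ w = 1 := by
      intro w hw
      by_contra hne
      rw [Pi.add_apply, hc w (by simpa using hne), add_zero] at hw
      exact hne hw
    have hsat : SysSat (σ + c) S := by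
      intro l hl
      have h₁ : evalForm l.1 σ = l.2 := hσ l hl
      have h₂ := hker l hl
      unfold evalForm at h₁ h₂
      simp [LitSat, evalForm, mul_add, Finset.sum_add_distrib, h₁, h₂]
    have hlt : (Finset.univ.filter fun w => (σ + c) w = 1).card < N := by
      rw [← hN]
      refine Finset.card_lt_card ((Finset.ssubset_iff_of_subset ?_).mpr ⟨v, hvO, ?_⟩)
      · intro w hw
        simpa using hsub w (by simpa using hw)
      · have hσv : σ v = 1 := by simpa using hvO
        simpa [hσv] using hv
    obtain ⟨τ, hτ, hτsub, hcard⟩ := ih _ hlt (σ + c) hsat rfl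
    exact ⟨τ, hτ, fun w hw => hsub w (hτsub w hw), hcard⟩

/-- If a linear system with `k` equations in the variables `p_{ij}` has a
HOLES-proper solution, then it has a HOLES-proper solution assigning `1` to at most `k`
variables. -/
theorem php_sparse_proper_solution (m n k : ℕ)
    (S : LinSystem (Fin m × Fin n)) (hcard : S.card = k)
    (hsol : ∃ σ, SysSat σ S ∧ HolesProper σ) :
    ∃ τ, SysSat τ S ∧ HolesProper τ ∧
      (Finset.univ.filter fun v : Fin m × Fin n => τ v = 1).card ≤ k := by
  obtain ⟨σ, hσ, hproper⟩ := hsol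
  obtain ⟨τ, hτ, hsub, hle⟩ := hσ.exists_sparse
  exact ⟨τ, hτ, fun i i' j hne h => hproper i i' j hne ⟨hsub _ h.1, hsub _ h.2⟩, hcard ▸ hle⟩
end

section
/- For all m > n ≥ 1: every tree-like Res(⊕) refutation of PHP_n^m has size at least 2^{n−1}, and Space(PHP_n^m) ≥ n − 1. -/
open Finset

variable {V : Type}

/-- A binary proof tree whose nodes are labeled with linear clauses. -/
inductive ProofTree (V : Type) : Type where
  | leaf (C : LinClause V) : ProofTree V
  | weak (C : LinClause V) (t : ProofTree V) : ProofTree V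
  | res (C : LinClause V) (t₁ t₂ : ProofTree V) : ProofTree V

/-- The clause at the root of a proof tree. -/
def ProofTree.concl : ProofTree V → LinClause V
  | .leaf C => C
  | .weak C _ => C
  | .res C _ _ => C

/-- The size of a proof tree: its number of nodes. -/
def ProofTree.size : ProofTree V → ℕ
  | .leaf _ => 1
  | .weak _ t => t.size + 1
  | .res _ t₁ t₂ => t₁.size + t₂.size + 1

/-- A proof tree is valid w.r.t. `φ` if leaves are labeled by clauses of `φ` and each
internal node is obtained from its children by the semantic weakening rule or the
resolution rule of Res(⊕). -/
def ProofTree.Valid [Fintype V] [DecidableEq V] (φ : LinCNF V) : ProofTree V → Prop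
  | .leaf C => C ∈ φ
  | .weak C t => t.Valid φ ∧ ∀ σ, ClauseSat σ t.concl → ClauseSat σ C
  | .res C t₁ t₂ => t₁.Valid φ ∧ t₂.Valid φ ∧
      ∃ (f : LinForm V) (A B : LinClause V),
        t₁.concl = insert (f, (0 : F2)) A ∧ t₂.concl = insert (f, (1 : F2)) B ∧ C = A ∪ B

/-- A tree-like Res(⊕) refutation of `φ`: a valid proof tree deriving the empty clause. -/
def IsTreeRefutation [Fintype V] [DecidableEq V] (φ : LinCNF V) (T : ProofTree V) : Prop :=
  T.Valid φ ∧ T.concl = ∅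

/-- A configuration: a finite set of linear clauses kept in memory. -/
abbrev Config (V : Type) : Type := Finset (LinClause V)

/-- Semantic inference: `C` follows from clauses in `S` by the resolution rule or the
semantic weakening rule. -/
def InferSem [Fintype V] [DecidableEq V] (S : Config V) (C : LinClause V) : Prop :=
  (∃ (f : LinForm V) (A B : LinClause V),
      insert (f, (0 : F2)) A ∈ S ∧ insert (f, (1 : F2)) B ∈ S ∧ C = A ∪ B) ∨
  (∃ D ∈ S, ∀ σ, ClauseSat σ D → ClauseSat σ C)

/-- The identically zero linear form. -/
def zeroForm (V : Type) : LinForm V := fun _ => 0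

/-- Syntactic inference: `C` follows from clauses in `S` by the resolution rule,
the simplification rule, the syntactic weakening rule, or the addition rule. -/
def InferSyn [Fintype V] [DecidableEq V] (S : Config V) (C : LinClause V) : Prop :=
  (∃ (f : LinForm V) (A B : LinClause V),
      insert (f, (0 : F2)) A ∈ S ∧ insert (f, (1 : F2)) B ∈ S ∧ C = A ∪ B) ∨
  (insert ((zeroForm V, (1 : F2)) : LinLit V) C ∈ S) ∨
  (∃ (D : LinClause V) (f : LinForm V) (α : F2), D ∈ S ∧ C = insert (f, α) D) ∨
  (∃ (D : LinClause V) (f₁ f₂ : LinForm V) (α₁ α₂ : F2),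
      insert (f₁, α₁) (insert (f₂, α₂) D) ∈ S ∧
      C = insert (f₁, α₁) (insert (f₁ + f₂, α₁ + α₂ + 1) D))

/-- One step of a configuration-style refutation: download a clause of `φ`,
erase a clause, or add a clause inferred (via `Inf`) from the current configuration. -/
inductive ConfigStep [Fintype V] [DecidableEq V] (φ : LinCNF V)
    (Inf : Config V → LinClause V → Prop) : Config V → Config V → Prop
  | download {S : Config V} {C : LinClause V} (h : C ∈ φ) : ConfigStep φ Inf S (insert C S)
  | erase {S : Config V} {C : LinClause V} (h : C ∈ S) : ConfigStep φ Inf S (S.erase C)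
  | infer {S : Config V} {C : LinClause V} (h : Inf S C) : ConfigStep φ Inf S (insert C S)

/-- A configuration-style Res(⊕) refutation of `φ` with inference rules `Inf`:
a sequence of configurations starting from the empty configuration, each obtained from
the previous one by a basic step, ending with a configuration containing the empty
clause. -/
def IsConfigRefutation [Fintype V] [DecidableEq V] (φ : LinCNF V)
    (Inf : Config V → LinClause V → Prop) (π : List (Config V)) : Prop :=
  π.head? = some (∅ : Config V) ∧ List.Chain' (ConfigStep φ Inf) π ∧
    ∃ S : Config V, π.getLast? = some S ∧ (∅ : LinClause V) ∈ S

/-- The space of a sequence of configurations: the maximum number of clauses in memory. -/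
def spaceOf (π : List (Config V)) : ℕ := (π.map Finset.card).foldr max 0

lemma f2_eq_zero_or_one (a : F2) : a = 0 ∨ a = 1 := by
  revert a; decide

lemma evalForm_add [Fintype V] (f : LinForm V) (σ τ : V → F2) :
    evalForm f (σ + τ) = evalForm f σ + evalForm f τ := by
  simp [evalForm, mul_add, sum_add_distrib]

lemma evalForm_add_left [Fintype V] (f g : LinForm V) (σ : V → F2) :
    evalForm (f + g) σ = evalForm f σ + evalForm g σ := by
  simp [evalForm, add_mul, sum_add_distrib]

lemma evalForm_single [Fintype V] [DecidableEq V] (v : V) (σ : V → F2) :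
    evalForm (Pi.single v 1) σ = σ v := by
  simp [evalForm, Pi.single_apply]

lemma litSat_posLit [Fintype V] [DecidableEq V] {v : V} {σ : V → F2} :
    LitSat σ (posLit v) ↔ σ v = 1 := by
  simp [LitSat, posLit, evalForm_single]

lemma litSat_negLit [Fintype V] [DecidableEq V] {v : V} {σ : V → F2} :
    LitSat σ (negLit v) ↔ σ v = 0 := by
  simp [LitSat, negLit, evalForm_single]

lemma sysSat_insert [Fintype V] [DecidableEq V] {σ : V → F2} {l : LinLit V} {S : LinSystem V} :
    SysSat σ (insert l S) ↔ LitSat σ l ∧ SysSat σ S := by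
  simp only [SysSat, mem_insert, forall_eq_or_imp]

/-- The solution set of a linear system is closed under sums of three solutions; here for the
system given by the negation of a clause. -/
lemma not_clauseSat_add_add [Fintype V] {C : LinClause V} {σ₁ σ₂ σ₃ : V → F2}
    (h₁ : ¬ ClauseSat σ₁ C) (h₂ : ¬ ClauseSat σ₂ C) (h₃ : ¬ ClauseSat σ₃ C) :
    ¬ ClauseSat (σ₁ + σ₂ + σ₃) C := by
  rintro ⟨l, hl, h⟩
  have k₁ : ¬ LitSat σ₁ l := fun h => h₁ ⟨l, hl, h⟩
  have k₂ : ¬ LitSat σ₂ l := fun h => h₂ ⟨l, hl, h⟩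
  have k₃ : ¬ LitSat σ₃ l := fun h => h₃ ⟨l, hl, h⟩
  simp only [LitSat, evalForm_add] at h k₁ k₂ k₃
  generalize evalForm l.1 σ₁ = a at *
  generalize evalForm l.1 σ₂ = b at *
  generalize evalForm l.1 σ₃ = c at *
  generalize l.2 = d at *
  revert a b c d
  decide

/-- The linear literal `l` implies the clause `C`. -/
def LitImplies [Fintype V] (l : LinLit V) (C : LinClause V) : Prop :=
  ∀ σ, LitSat σ l → ClauseSat σ C

lemma litImplies_of_mem [Fintype V] {l : LinLit V} {C : LinClause V} (h : l ∈ C) :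
    LitImplies l C := fun _ hσ => ⟨l, h, hσ⟩

set_option synthInstance.maxSize 1024 in
set_option synthInstance.maxHeartbeats 400000 in
/-- If two equations together imply a clause, then so does one of them or their sum. -/
lemma litImplies_of_pair [Fintype V] {l₁ l₂ : LinLit V} {C : LinClause V}
    (h : ∀ σ, LitSat σ l₁ → LitSat σ l₂ → ClauseSat σ C) :
    LitImplies l₁ C ∨ LitImplies l₂ C ∨ LitImplies (l₁ + l₂) C := by
  by_contra! hc
  simp only [LitImplies, not_forall] at hc
  obtain ⟨⟨σ₁, a₁, b₁⟩, ⟨σ₂, a₂, b₂⟩, ⟨σ₃, a₃, b₃⟩⟩ := hc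
  have c₁ : ¬ LitSat σ₁ l₂ := fun k => b₁ (h _ a₁ k)
  have c₂ : ¬ LitSat σ₂ l₁ := fun k => b₂ (h _ k a₂)
  have c₃ : ¬ (LitSat σ₃ l₁ ∧ LitSat σ₃ l₂) := fun k => b₃ (h _ k.1 k.2)
  have c : ¬ (LitSat (σ₁ + σ₂ + σ₃) l₁ ∧ LitSat (σ₁ + σ₂ + σ₃) l₂) :=
    fun k => not_clauseSat_add_add b₁ b₂ b₃ (h _ k.1 k.2)
  simp only [LitSat, evalForm_add, evalForm_add_left, Prod.fst_add, Prod.snd_add] at *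
  generalize evalForm l₁.1 σ₁ = x₁, evalForm l₁.1 σ₂ = x₂, evalForm l₁.1 σ₃ = x₃,
    evalForm l₂.1 σ₁ = y₁, evalForm l₂.1 σ₂ = y₂, evalForm l₂.1 σ₃ = y₃,
    l₁.2 = u, l₂.2 = w at *
  clear h b₁ b₂ b₃
  subst a₁ a₂
  revert x₁ x₂ x₃ y₁ y₂ y₃
  decide

lemma LitSat.add [Fintype V] {σ : V → F2} {l₁ l₂ : LinLit V} (h₁ : LitSat σ l₁)
    (h₂ : LitSat σ l₂) : LitSat σ (l₁ + l₂) := by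
  simp only [LitSat, evalForm_add_left, Prod.fst_add, Prod.snd_add] at *
  rw [h₁, h₂]

lemma clauseSat_holeClause {m n : ℕ} {σ : Fin m × Fin n → F2} (hσ : HolesProper σ)
    {i i' : Fin m} (hi : i ≠ i') (k : Fin n) : ClauseSat σ (holeClause i i' k) := by
  rcases f2_eq_zero_or_one (σ (i, k)) with h | h
  · exact ⟨negLit (i, k), by simp [holeClause], litSat_negLit.2 h⟩
  · rcases f2_eq_zero_or_one (σ (i', k)) with h' | h'
    · exact ⟨negLit (i', k), by simp [holeClause], litSat_negLit.2 h'⟩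
    · exact absurd ⟨h, h'⟩ (hσ i i' k hi)

/-- A system of fewer than `n` equations with a proper solution has a proper solution in which
any given pigeon occupies some hole: by linear dependence, some nonempty set of holes can be
reassigned to that pigeon without changing the values of the equations. -/
lemma exists_holesProper_pigeon {m n : ℕ} {S : LinSystem (Fin m × Fin n)} (hS : S.card < n)
    {σ : Fin m × Fin n → F2} (hσ : HolesProper σ) (hsat : SysSat σ S) (i : Fin m) :
    ∃ τ, HolesProper τ ∧ SysSat τ S ∧ ∃ k, τ (i, k) = 1 := by
  let d : Fin m × Fin n → F2 := fun v => (if v.1 = i then 1 else 0) + σ v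
  let L : (Fin n → F2) →ₗ[F2] (S → F2) :=
    { toFun := fun c l => evalForm l.1.1 fun v => c v.2 * d v
      map_add' := fun c c' => by
        funext l
        rw [Pi.add_apply, ← evalForm_add]
        congr 1
        funext v
        simp [add_mul]
      map_smul' := fun a c => by
        funext l
        simp only [evalForm, Pi.smul_apply, smul_eq_mul, RingHom.id_apply, mul_sum]
        exact sum_congr rfl fun v _ => by ring }
  obtain ⟨c, hc, hc0⟩ := (Submodule.ne_bot_iff _).1
    (LinearMap.ker_ne_bot_of_finrank_lt (f := L) (by simpa using hS))
  obtain ⟨k, hk⟩ := Function.ne_iff.1 hc0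
  have hval : ∀ j, c j = 1 → ∀ i', σ (i', j) + c j * d (i', j) = if i' = i then 1 else 0 := by
    intro j hj i'
    simp only [d, hj, one_mul]
    rw [add_comm, add_assoc, CharTwo.add_self_eq_zero, add_zero]
  refine ⟨σ + fun v => c v.2 * d v, ?_, ?_, k, ?_⟩
  · intro i₁ i₂ j hne h
    simp only [Pi.add_apply] at h
    rcases f2_eq_zero_or_one (c j) with hj | hj
    · exact hσ i₁ i₂ j hne (by simpa [hj] using h)
    · rw [hval j hj, hval j hj] at h
      by_cases h₁ : i₁ = i
      · have h₂ : i₂ ≠ i := fun h₂ => hne (h₁.trans h₂.symm)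
        simp [h₂] at h
      · simp [h₁] at h
  · intro l hl
    have h := congrFun (LinearMap.mem_ker.1 hc) ⟨l, hl⟩
    change evalForm l.1 (fun v => c v.2 * d v) = 0 at h
    rw [LitSat, evalForm_add, h, add_zero]
    exact hsat l hl
  · have h1 : c k = 1 := (f2_eq_zero_or_one _).resolve_left hk
    exact (hval k h1 i).trans (if_pos rfl)

lemma exists_holesProper_clauseSat {m n : ℕ} {S : LinSystem (Fin m × Fin n)} (hS : S.card < n)
    {σ : Fin m × Fin n → F2} (hσ : HolesProper σ) (hsat : SysSat σ S)
    {C : LinClause (Fin m × Fin n)} (hC : C ∈ PHPCNF m n) :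
    ∃ τ, HolesProper τ ∧ SysSat τ S ∧ ClauseSat τ C := by
  rcases hC with ⟨i, rfl⟩ | ⟨i, i', k, hi, rfl⟩
  · obtain ⟨τ, hτ, hsat', k, hk⟩ := exists_holesProper_pigeon hS hσ hsat i
    exact ⟨τ, hτ, hsat', posLit (i, k), mem_image_of_mem _ (mem_univ k), litSat_posLit.2 hk⟩
  · exact ⟨σ, hσ, hsat, clauseSat_holeClause hσ hi k⟩

lemma ProofTree.one_le_size (T : ProofTree V) : 1 ≤ T.size := by
  cases T <;> simp [ProofTree.size]

/-- A subtree whose conclusion is falsified by all proper solutions of a system `S` that has a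
proper solution is of size at least `2 ^ (n - 1 - |S|)`. -/
lemma ProofTree.two_pow_le_size {m n : ℕ} (T : ProofTree (Fin m × Fin n))
    (hT : T.Valid (PHPCNF m n)) (S : LinSystem (Fin m × Fin n))
    (hS : ∃ σ, HolesProper σ ∧ SysSat σ S)
    (hfalse : ∀ σ, HolesProper σ → SysSat σ S → ¬ ClauseSat σ T.concl) :
    2 ^ (n - 1 - S.card) ≤ T.size := by
  induction T generalizing S with
  | leaf C =>
    obtain ⟨σ, hσ, hsat⟩ := hS
    have hcard : n ≤ S.card := by
      by_contra! hlt
      obtain ⟨τ, hτ, hτS, hτC⟩ := exists_holesProper_clauseSat hlt hσ hsat hT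
      exact hfalse τ hτ hτS hτC
    rw [show n - 1 - S.card = 0 by omega]
    exact ProofTree.one_le_size _
  | weak C t ih =>
    have := ih hT.1 S hS fun σ hσ hsat h => hfalse σ hσ hsat (hT.2 σ h)
    exact this.trans (Nat.le_succ _)
  | res C t₁ t₂ ih₁ ih₂ =>
    obtain ⟨hT₁, hT₂, f, A, B, h₁, h₂, rfl⟩ := hT
    have hA : ∀ σ, HolesProper σ → SysSat σ S → ¬ ClauseSat σ A :=
      fun σ hσ hsat ⟨l, hl, h⟩ => hfalse σ hσ hsat ⟨l, mem_union_left _ hl, h⟩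
    have hB : ∀ σ, HolesProper σ → SysSat σ S → ¬ ClauseSat σ B :=
      fun σ hσ hsat ⟨l, hl, h⟩ => hfalse σ hσ hsat ⟨l, mem_union_right _ hl, h⟩
    have hf₁ : ∀ σ, HolesProper σ → SysSat σ S → LitSat σ (f, 1) → ¬ ClauseSat σ t₁.concl := by
      rintro σ hσ hsat hf ⟨l, hl, h⟩
      rw [h₁, mem_insert] at hl
      rcases hl with rfl | hl
      · exact zero_ne_one (h.symm.trans hf)
      · exact hA σ hσ hsat ⟨l, hl, h⟩
    have hf₂ : ∀ σ, HolesProper σ → SysSat σ S → LitSat σ (f, 0) → ¬ ClauseSat σ t₂.concl := by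
      rintro σ hσ hsat hf ⟨l, hl, h⟩
      rw [h₂, mem_insert] at hl
      rcases hl with rfl | hl
      · exact zero_ne_one (hf.symm.trans h)
      · exact hB σ hσ hsat ⟨l, hl, h⟩
    have hcases : ∀ σ, LitSat σ (f, 0) ∨ LitSat σ (f, 1) := fun σ => f2_eq_zero_or_one _
    rw [ProofTree.size]
    by_cases e₁ : ∃ σ, HolesProper σ ∧ SysSat σ (insert (f, 1) S)
    · by_cases e₂ : ∃ σ, HolesProper σ ∧ SysSat σ (insert (f, 0) S)
      · have k₁ := ih₁ hT₁ _ e₁ fun σ hσ hsat =>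
          hf₁ σ hσ (sysSat_insert.1 hsat).2 (sysSat_insert.1 hsat).1
        have k₂ := ih₂ hT₂ _ e₂ fun σ hσ hsat =>
          hf₂ σ hσ (sysSat_insert.1 hsat).2 (sysSat_insert.1 hsat).1
        have c₁ : 2 ^ (n - 1 - S.card - 1) ≤ 2 ^ (n - 1 - (insert (f, (1 : F2)) S).card) :=
          Nat.pow_le_pow_right two_pos (by have := card_insert_le (f, (1 : F2)) S; omega)
        have c₂ : 2 ^ (n - 1 - S.card - 1) ≤ 2 ^ (n - 1 - (insert (f, (0 : F2)) S).card) :=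
          Nat.pow_le_pow_right two_pos (by have := card_insert_le (f, (0 : F2)) S; omega)
        rcases Nat.eq_zero_or_pos (n - 1 - S.card) with h0 | hpos
        · rw [h0]; omega
        · have : 2 ^ (n - 1 - S.card) = 2 * 2 ^ (n - 1 - S.card - 1) := by
            rw [← pow_succ', Nat.sub_add_cancel hpos]
          omega
      · have := ih₁ hT₁ S hS fun σ hσ hsat => hf₁ σ hσ hsat <|
          (hcases σ).resolve_left fun h => e₂ ⟨σ, hσ, sysSat_insert.2 ⟨h, hsat⟩⟩
        omega
    · have := ih₂ hT₂ S hS fun σ hσ hsat => hf₂ σ hσ hsat <|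
        (hcases σ).resolve_right fun h => e₁ ⟨σ, hσ, sysSat_insert.2 ⟨h, hsat⟩⟩
      omega

/-- Each clause of the configuration `S` is implied by a linear equation, in such a way that these
equations have a common proper solution. -/
def LocallySat {m n : ℕ} (S : Config (Fin m × Fin n)) : Prop :=
  ∃ (g : LinClause (Fin m × Fin n) → LinLit (Fin m × Fin n)) (σ : Fin m × Fin n → F2),
    HolesProper σ ∧ ∀ C ∈ S, LitSat σ (g C) ∧ LitImplies (g C) C

lemma locallySat_empty {m n : ℕ} : LocallySat (∅ : Config (Fin m × Fin n)) :=
  ⟨fun _ => 0, 0, by simp [HolesProper], by simp⟩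

lemma locallySat_insert {m n : ℕ} {S : Config (Fin m × Fin n)} {C : LinClause (Fin m × Fin n)}
    (g : LinClause (Fin m × Fin n) → LinLit (Fin m × Fin n)) {σ : Fin m × Fin n → F2}
    (hσ : HolesProper σ) (hg : ∀ D ∈ S, LitSat σ (g D) ∧ LitImplies (g D) D)
    {l : LinLit (Fin m × Fin n)} (hl : LitSat σ l) (hC : LitImplies l C) :
    LocallySat (insert C S) := by
  refine ⟨Function.update g C l, σ, hσ, fun D hD => ?_⟩
  by_cases h : D = C
  · subst h
    simpa using ⟨hl, hC⟩
  · simpa [h] using hg D (mem_of_mem_insert_of_ne hD h)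

lemma LocallySat.step {m n : ℕ} {S S' : Config (Fin m × Fin n)} (hcard : S.card < n)
    (hS : LocallySat S) (hstep : ConfigStep (PHPCNF m n) InferSem S S') : LocallySat S' := by
  obtain ⟨g, σ, hσ, hg⟩ := hS
  cases hstep with
  | @download C hC =>
    obtain ⟨τ, hτ, hsat, l, hl, hlτ⟩ := exists_holesProper_clauseSat
      (card_image_le.trans_lt hcard : (S.image g).card < n) hσ
      (by simpa [SysSat] using fun D hD => (hg D hD).1) hC
    exact locallySat_insert g hτ (fun D hD => ⟨hsat _ (mem_image_of_mem g hD), (hg D hD).2⟩) hlτ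
      (litImplies_of_mem hl)
  | erase h => exact ⟨g, σ, hσ, fun D hD => hg D (mem_of_mem_erase hD)⟩
  | @infer C h =>
    rcases h with ⟨f, A, B, hA, hB, rfl⟩ | ⟨D, hD, h⟩
    · have hres : ∀ τ, LitSat τ (g (insert (f, 0) A)) → LitSat τ (g (insert (f, 1) B)) →
          ClauseSat τ (A ∪ B) := by
        intro τ h₁ h₂
        obtain ⟨l₁, hl₁, k₁⟩ := (hg _ hA).2 τ h₁
        obtain ⟨l₂, hl₂, k₂⟩ := (hg _ hB).2 τ h₂
        rw [mem_insert] at hl₁ hl₂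
        rcases hl₁ with rfl | hl₁
        · rcases hl₂ with rfl | hl₂
          · exact absurd (k₁.symm.trans k₂) zero_ne_one
          · exact ⟨l₂, mem_union_right _ hl₂, k₂⟩
        · exact ⟨l₁, mem_union_left _ hl₁, k₁⟩
      rcases litImplies_of_pair hres with h | h | h
      · exact locallySat_insert g hσ hg (hg _ hA).1 h
      · exact locallySat_insert g hσ hg (hg _ hB).1 h
      · exact locallySat_insert g hσ hg ((hg _ hA).1.add (hg _ hB).1) h
    · exact locallySat_insert g hσ hg (hg D hD).1 fun τ hτ => h τ ((hg D hD).2 τ hτ)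

lemma LocallySat.getLast {m n : ℕ} {π : List (Config (Fin m × Fin n))}
    {S S' : Config (Fin m × Fin n)} (hhead : π.head? = some S)
    (hchain : π.IsChain (ConfigStep (PHPCNF m n) InferSem)) (hlast : π.getLast? = some S')
    (hcard : ∀ T ∈ π, T.card < n) (hS : LocallySat S) : LocallySat S' := by
  induction π generalizing S with
  | nil => simp at hhead
  | cons T π ih =>
    obtain rfl : T = S := by simpa using hhead
    cases π with
    | nil =>
      obtain rfl : T = S' := by simpa using hlast
      exact hS
    | cons U π =>
      rw [List.isChain_cons_cons] at hchain
      exact ih rfl hchain.2 (by simpa using hlast) (fun W hW => hcard W (by simp [hW]))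
        (hS.step (hcard T (by simp)) hchain.1)

lemma card_le_spaceOf {π : List (Config V)} {S : Config V} (hS : S ∈ π) :
    S.card ≤ spaceOf π := by
  induction π with
  | nil => simp at hS
  | cons T π ih =>
    simp only [spaceOf, List.map_cons, List.foldr_cons] at ih ⊢
    rcases List.mem_cons.1 hS with rfl | h
    · exact le_max_left _ _
    · exact (ih h).trans (le_max_right _ _)


/-- For `m > n ≥ 1`: every tree-like Res(⊕) refutation of `PHP_n^m` has
size at least `2^(n-1)`, and every configuration-style Res(⊕) refutation of `PHP_n^m` has
space at least `n - 1`. -/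
theorem php_size_and_space_lower_bounds (m n : ℕ) (hn : 1 ≤ n) (hmn : n < m) :
    (∀ T : ProofTree (Fin m × Fin n),
        IsTreeRefutation (PHPCNF m n) T → 2 ^ (n - 1) ≤ T.size) ∧
    (∀ π : List (Config (Fin m × Fin n)),
        IsConfigRefutation (PHPCNF m n) InferSem π → n - 1 ≤ spaceOf π) := by
  refine ⟨fun T ⟨hT, hconcl⟩ => ?_, fun π ⟨hhead, hchain, S, hlast, hS⟩ => ?_⟩
  · have := T.two_pow_le_size hT ∅ ⟨0, by simp [HolesProper], by simp [SysSat]⟩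
      fun σ _ _ ⟨l, hl, _⟩ => by simp [hconcl] at hl
    simpa using this
  · by_contra! hlt
    obtain ⟨g, σ, -, hg⟩ := LocallySat.getLast hhead hchain hlast
      (fun T hT => by have := card_le_spaceOf hT; omega) locallySat_empty
    obtain ⟨l, hl, -⟩ := (hg ∅ hS).2 σ (hg ∅ hS).1
    simp at hl
end

section
/- For all n ≥ 2, Ordering_n is (n−2)-extensible w.r.t. ORDER_n: for every linear system Ax = b over 𝔽₂ in the variables x_{ij} with fewer than n−2 equations that has an ORDER_n-proper solution, and every i ∈ [n], there exists an ORDER_n-proper solution of Ax = b that satisfies the non-minimality clause NM_i, i.e., encodes a strict linear order on [n] in which i is not the minimum element. -/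
open Finset

variable {V : Type}

/-- An assignment to the variables `x_{ij}` is ORDER-proper if setting `i ≺ j ⟺ x_{ij} = 1`
defines a strict linear order on `[n]`: it satisfies all antisymmetry, totality, and
transitivity clauses. -/
def OrderProper {n : ℕ} (σ : Fin n × Fin n → F2) : Prop :=
  (∀ i j : Fin n, i ≠ j → ¬(σ (i, j) = 1 ∧ σ (j, i) = 1)) ∧
  (∀ i j : Fin n, i ≠ j → σ (i, j) = 1 ∨ σ (j, i) = 1) ∧
  (∀ i j k : Fin n, i ≠ j → j ≠ k → i ≠ k →
    σ (i, j) = 1 → σ (j, k) = 1 → σ (i, k) = 1)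

/-- The non-minimality clause `NM_i = ⋁_{j ≠ i} x_{ji}`. -/
def nonMinClause {n : ℕ} (i : Fin n) : LinClause (Fin n × Fin n) :=
  (Finset.univ.filter fun j : Fin n => j ≠ i).image fun j => posLit (j, i)

/-- The ordering principle `Ordering_n` as a linear CNF. -/
def OrderingCNF (n : ℕ) : LinCNF (Fin n × Fin n) :=
  {C | ∃ i j : Fin n, i ≠ j ∧ C = ({negLit (i, j), negLit (j, i)} : LinClause (Fin n × Fin n))} ∪
  {C | ∃ i j : Fin n, i ≠ j ∧ C = ({posLit (i, j), posLit (j, i)} : LinClause (Fin n × Fin n))} ∪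
  {C | ∃ i j k : Fin n, i ≠ j ∧ j ≠ k ∧ i ≠ k ∧
        C = ({negLit (i, j), negLit (j, k), posLit (i, k)} : LinClause (Fin n × Fin n))} ∪
  {C | ∃ i : Fin n, C = nonMinClause i}

/-- The variation of an assignment `σ` encoding a linear order: the elements `a` with `y a = 1`
are moved to the front, in reversed order. This changes the relation between `a` and `b` exactly
when the larger of the two is moved, and is therefore linear in `y`. -/
def moveShift {n : ℕ} (σ : Fin n × Fin n → F2) : (Fin n → F2) →ₗ[F2] (Fin n × Fin n → F2) where
  toFun y p := σ p * y p.2 + σ p.swap * y p.1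
  map_add' y z := by
    funext p
    simp only [Pi.add_apply]
    ring
  map_smul' c y := by
    funext p
    simp only [Pi.smul_apply, smul_eq_mul, RingHom.id_apply]
    ring

theorem moveShift_apply {n : ℕ} (σ : Fin n × Fin n → F2) (y : Fin n → F2) (a b : Fin n) :
    moveShift σ y (a, b) = σ (a, b) * y b + σ (b, a) * y a := rfl

/-- Evaluation of a linear form, as a linear map. -/
def evalFormHom [Fintype V] (f : LinForm V) : (V → F2) →ₗ[F2] F2 where
  toFun := evalForm f
  map_add' σ τ := by simp [evalForm, mul_add, Finset.sum_add_distrib]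
  map_smul' c σ := by simp [evalForm, Finset.mul_sum, mul_left_comm]

theorem OrderProper.swap {n : ℕ} {σ : Fin n × Fin n → F2} (h : OrderProper σ) {a b : Fin n}
    (hab : a ≠ b) : σ (b, a) = 1 + σ (a, b) := by
  have key : ∀ p q : F2, ¬(p = 1 ∧ q = 1) → (p = 1 ∨ q = 1) → q = 1 + p := by decide
  exact key _ _ (h.1 a b hab) (h.2.1 a b hab)

theorem OrderProper.add_moveShift {n : ℕ} {σ : Fin n × Fin n → F2} (h : OrderProper σ)
    (y : Fin n → F2) : OrderProper (σ + moveShift σ y) := by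
  refine ⟨fun a b hab => ?_, fun a b hab => ?_, fun a b c hab hbc hac => ?_⟩
  · simp only [Pi.add_apply, moveShift_apply, h.swap hab]
    generalize σ (a, b) = p, y a = u, y b = v
    revert p u v
    decide
  · simp only [Pi.add_apply, moveShift_apply, h.swap hab]
    generalize σ (a, b) = p, y a = u, y b = v
    revert p u v
    decide
  · have h₁ := h.2.2 a b c hab hbc hac
    have h₂ := h.2.2 c b a hbc.symm hab.symm hac.symm
    simp only [h.swap hab, h.swap hbc, h.swap hac] at h₂
    simp only [Pi.add_apply, moveShift_apply, h.swap hab, h.swap hbc, h.swap hac]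
    generalize σ (a, b) = p, σ (b, c) = q, σ (a, c) = r, y a = u, y b = v, y c = w at *
    clear h hab hbc hac
    revert p q r u v w
    decide

/-- For `n ≥ 2`, `Ordering_n` is `(n-2)`-extensible w.r.t. `ORDER_n`:
every linear system with fewer than `n-2` equations having an ORDER-proper solution has,
for each `i`, an ORDER-proper solution satisfying the non-minimality clause `NM_i`. -/
theorem ordering_extensible (n : ℕ) (hn : 2 ≤ n)
    (S : LinSystem (Fin n × Fin n)) (hcard : S.card < n - 2)
    (hsol : ∃ σ, SysSat σ S ∧ OrderProper σ) (i : Fin n) :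
    ∃ τ, SysSat τ S ∧ OrderProper τ ∧ ∃ j : Fin n, j ≠ i ∧ τ (j, i) = 1 := by
  obtain ⟨σ, hS, hσ⟩ := hsol
  by_cases hmin : ∃ j : Fin n, j ≠ i ∧ σ (j, i) = 1
  · exact ⟨σ, hS, hσ, hmin⟩
  let L : (Fin n → F2) →ₗ[F2] (S → F2) × F2 :=
    (LinearMap.pi fun l : S => evalFormHom l.1.1 ∘ₗ moveShift σ).prod (LinearMap.proj i)
  have hL : LinearMap.ker L ≠ ⊥ := by
    apply LinearMap.ker_ne_bot_of_finrank_lt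
    simp only [Module.finrank_prod, Module.finrank_fintype_fun_eq_card, Module.finrank_self,
      Fintype.card_coe, Fintype.card_fin]
    omega
  obtain ⟨y, hy, hy0⟩ := Submodule.exists_mem_ne_zero_of_ne_bot hL
  obtain ⟨hyS, hyi⟩ := Prod.ext_iff.mp (LinearMap.mem_ker.mp hy)
  replace hyi : y i = 0 := hyi
  obtain ⟨j, hj⟩ := Function.ne_iff.mp hy0
  have hji : j ≠ i := by
    rintro rfl
    exact hj hyi
  refine ⟨σ + moveShift σ y, fun l hl => ?_, hσ.add_moveShift y, j, hji, ?_⟩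
  · have hl0 : evalFormHom l.1 (moveShift σ y) = 0 := congrFun hyS ⟨l, hl⟩
    change evalFormHom l.1 (σ + moveShift σ y) = l.2
    rw [map_add, hl0, add_zero]
    exact hS l hl
  · have hσji : σ (j, i) ≠ 1 := fun h => hmin ⟨j, hji, h⟩
    have key : ∀ p u : F2, p ≠ 1 → u ≠ 0 → p + (p * 0 + (1 + p) * u) = 1 := by decide
    rw [Pi.add_apply, moveShift_apply, hσ.swap hji, hyi]
    exact key _ _ hσji hj
end

section
/- For all n ≥ 3, DLO_n is ⌊(n−3)/3⌋-extensible w.r.t. WORDER_n: for every linear system Av = b over 𝔽₂ in the variables of DLO_n with fewer than ⌊(n−3)/3⌋ equations that has a WORDER_n-proper solution, and every density clause D_{st}, there exists a WORDER_n-proper solution of Av = b that satisfies D_{st}. -/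
open Finset

variable {V : Type}

/-- The variables of `DLO_n`: order variables `x_{ij}` and witness variables `z_{ikj}`. -/
abbrev DLOVar (n : ℕ) : Type := (Fin n × Fin n) ⊕ (Fin n × Fin n × Fin n)

/-- The order variable `x_{ij}`. -/
def xvar {n : ℕ} (i j : Fin n) : DLOVar n := Sum.inl (i, j)

/-- The witness variable `z_{ikj}`. -/
def zvar {n : ℕ} (i k j : Fin n) : DLOVar n := Sum.inr (i, k, j)

/-- An assignment is WORDER-proper if it satisfies every antisymmetry, totality,
transitivity, and witness-semantics clause of `DLO_n`. -/
def WOrderProper {n : ℕ} (σ : DLOVar n → F2) : Prop :=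
  (∀ i j : Fin n, i ≠ j → ¬(σ (xvar i j) = 1 ∧ σ (xvar j i) = 1)) ∧
  (∀ i j : Fin n, i ≠ j → σ (xvar i j) = 1 ∨ σ (xvar j i) = 1) ∧
  (∀ i j k : Fin n, i ≠ j → j ≠ k → i ≠ k →
    σ (xvar i j) = 1 → σ (xvar j k) = 1 → σ (xvar i k) = 1) ∧
  (∀ i k j : Fin n, i ≠ k → k ≠ j → i ≠ j →
    σ (zvar i k j) = 1 → σ (xvar i k) = 1 ∧ σ (xvar k j) = 1)

/-- The assignment `σ` satisfies the density clause
`D_{st} = ¬x_{st} ∨ ⋁_{k ≠ s,t} z_{skt}`. -/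
def DensitySat {n : ℕ} (s t : Fin n) (σ : DLOVar n → F2) : Prop :=
  σ (xvar s t) = 0 ∨ ∃ k : Fin n, k ≠ s ∧ k ≠ t ∧ σ (zvar s k t) = 1

/-- A function over `F2` depending only on the coordinates in `T` is given by a polynomial of
degree at most `#T`. -/
theorem exists_mvPolynomial_of_dependsOn {κ : Type*} [DecidableEq κ] (T : Finset κ) :
    ∀ g : (κ → F2) → F2, (∀ y y', (∀ k ∈ T, y k = y' k) → g y = g y') →
      ∃ p : MvPolynomial κ F2, p.totalDegree ≤ #T ∧ ∀ y, MvPolynomial.eval y p = g y := by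
  induction T using Finset.induction_on with
  | empty =>
    intro g hg
    exact ⟨MvPolynomial.C (g 0), by simp, fun y => by simpa using hg 0 y (by simp)⟩
  | insert a T ha ih =>
    intro g hg
    have restrict (c : F2) : ∃ p : MvPolynomial κ F2, p.totalDegree ≤ #T ∧
        ∀ y, MvPolynomial.eval y p = g (Function.update y a c) := by
      refine ih _ fun y y' h => hg _ _ fun k hk => ?_
      by_cases hka : k = a
      · subst hka; simp
      · simpa [hka] using h k (by simpa [hka] using hk)
    obtain ⟨p, hp, hpe⟩ := restrict 0
    obtain ⟨q, hq, hqe⟩ := restrict 1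
    refine ⟨p + MvPolynomial.X a * (q - p), ?_, fun y => ?_⟩
    · rw [card_insert_of_notMem ha]
      have h₁ := MvPolynomial.totalDegree_add p (MvPolynomial.X a * (q - p))
      have h₂ := MvPolynomial.totalDegree_mul (MvPolynomial.X a) (q - p)
      have h₃ := MvPolynomial.totalDegree_sub q p
      rw [MvPolynomial.totalDegree_X] at h₂
      omega
    · simp only [map_add, map_mul, map_sub, MvPolynomial.eval_X, hpe, hqe]
      obtain h | h : y a = 0 ∨ y a = 1 := by generalize y a = c; revert c; decide
      · rw [← h, Function.update_eq_self]; simp [h]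
      · rw [h, one_mul, add_sub_cancel, ← h, Function.update_eq_self]

/-- A family of assignments, each of whose coordinates depends on at most `d` of the parameters,
that solves a linear system of fewer than `#κ / d` equations at the parameter `0` also solves it
at a nonzero parameter. -/
theorem exists_ne_zero_sysSat {V κ : Type} [Fintype V] [Fintype κ] [DecidableEq κ] (d : ℕ)
    (P : (κ → F2) → V → F2) (T : V → Finset κ) (hT : ∀ v, #(T v) ≤ d)
    (hP : ∀ v y y', (∀ k ∈ T v, y k = y' k) → P y v = P y' v)
    (S : LinSystem V) (hS : #S * d < Fintype.card κ) (h0 : SysSat (P 0) S) :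
    ∃ y, y ≠ 0 ∧ SysSat (P y) S := by
  choose p hp hpe using fun v => exists_mvPolynomial_of_dependsOn (T v) (fun y => P y v) (hP v)
  let f : LinLit V → MvPolynomial κ F2 :=
    fun l => ∑ v, MvPolynomial.C (l.1 v) * p v - MvPolynomial.C l.2
  have hf (l : LinLit V) (y : κ → F2) : MvPolynomial.eval y (f l) = 0 ↔ LitSat (P y) l := by
    simp [f, LitSat, evalForm, hpe, sub_eq_zero]
  have hdeg (l : LinLit V) : (f l).totalDegree ≤ d := by
    refine (MvPolynomial.totalDegree_sub_C_le _ _).trans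
      (MvPolynomial.totalDegree_finsetSum_le fun v _ => ?_)
    refine (MvPolynomial.totalDegree_mul _ _).trans ?_
    rw [MvPolynomial.totalDegree_C, zero_add]
    exact (hp v).trans (hT v)
  have hdvd := char_dvd_card_solutions_of_sum_lt (K := F2) 2 (s := S) (f := f)
    ((sum_le_card_nsmul S _ d fun l _ => hdeg l).trans_lt (by simpa using hS))
  have hcard : 0 < Fintype.card {y : κ → F2 // ∀ l ∈ S, MvPolynomial.eval y (f l) = 0} :=
    Fintype.card_pos_iff.mpr ⟨0, fun l hl => (hf l 0).mpr (h0 l hl)⟩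
  obtain ⟨⟨y, hy⟩, hne⟩ := Fintype.exists_ne_of_one_lt_card
    (by have := Nat.le_of_dvd hcard hdvd; omega)
    (⟨0, fun l hl => (hf l 0).mpr (h0 l hl)⟩ :
      {y : κ → F2 // ∀ l ∈ S, MvPolynomial.eval y (f l) = 0})
  exact ⟨y, fun h => hne (Subtype.ext h), fun l hl => (hf l y).mp (hy l hl)⟩

section Gather

variable {n : ℕ}

/-- The region of `k` relative to `s < t` in the order of `σ`: `0` below `s`, `1` at `s`,
`2` strictly between, `3` at `t`, `4` above `t`. Elements selected by `y` are sent to region `2`. -/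
def region (s t : Fin n) (σ : DLOVar n → F2) (y : {k : Fin n // k ≠ s ∧ k ≠ t} → F2)
    (k : Fin n) : ℕ :=
  if h : k ≠ s ∧ k ≠ t then
    if y ⟨k, h⟩ = 1 then 2
    else if σ (xvar k s) = 1 then 0 else if σ (xvar k t) = 1 then 2 else 4
  else if k = s then 1 else 3

/-- The order of `σ` rearranged lexicographically by region. -/
def gatherX (s t : Fin n) (σ : DLOVar n → F2) (y : {k : Fin n // k ≠ s ∧ k ≠ t} → F2)
    (i j : Fin n) : F2 :=
  if region s t σ y i < region s t σ y j then 1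
  else if region s t σ y j < region s t σ y i then 0
  else σ (xvar i j)

/-- The witness variables accompanying `gatherX`: `z_{skt}` records whether `k` is selected, and
the others keep their value in `σ` unless the new order forbids it. -/
def gatherZ (s t : Fin n) (σ : DLOVar n → F2) (y : {k : Fin n // k ≠ s ∧ k ≠ t} → F2)
    (i k j : Fin n) : F2 :=
  if h : (k ≠ s ∧ k ≠ t) ∧ i = s ∧ j = t then y ⟨k, h.1⟩
  else if (i ≠ k ∧ k ≠ j ∧ i ≠ j) ∧
      ¬(gatherX s t σ y i k = 1 ∧ gatherX s t σ y k j = 1) then 0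
  else σ (zvar i k j)

/-- The assignment obtained from `σ` by moving the elements selected by `y` strictly between
`s` and `t` and making them witnesses of density. -/
def gather (s t : Fin n) (σ : DLOVar n → F2) (y : {k : Fin n // k ≠ s ∧ k ≠ t} → F2) :
    DLOVar n → F2 :=
  Sum.elim (fun p => gatherX s t σ y p.1 p.2) (fun p => gatherZ s t σ y p.1 p.2.1 p.2.2)

/-- The elements occurring in a variable. -/
def varSupport : DLOVar n → Finset (Fin n) :=
  Sum.elim (fun p => {p.1, p.2}) (fun p => {p.1, p.2.1, p.2.2})

theorem card_varSupport_le (v : DLOVar n) : #(varSupport v) ≤ 3 := by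
  rcases v with ⟨i, j⟩ | ⟨i, k, j⟩
  · exact card_le_two.trans (by norm_num)
  · exact card_le_three

variable {s t : Fin n} {σ : DLOVar n → F2}

theorem region_congr {y y' : {k : Fin n // k ≠ s ∧ k ≠ t} → F2} {k : Fin n}
    (h : ∀ u, u.1 = k → y u = y' u) : region s t σ y k = region s t σ y' k := by
  unfold region
  split_ifs <;> grind

theorem gather_congr {y y' : {k : Fin n // k ≠ s ∧ k ≠ t} → F2} (v : DLOVar n)
    (h : ∀ u, u.1 ∈ varSupport v → y u = y' u) : gather s t σ y v = gather s t σ y' v := by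
  rcases v with ⟨i, j⟩ | ⟨i, k, j⟩
  · have hi : region s t σ y i = region s t σ y' i :=
      region_congr fun u hu => h u (by simp [varSupport, hu])
    have hj : region s t σ y j = region s t σ y' j :=
      region_congr fun u hu => h u (by simp [varSupport, hu])
    simp only [gather, gatherX, Sum.elim_inl, hi, hj]
  · have hi : region s t σ y i = region s t σ y' i :=
      region_congr fun u hu => h u (by simp [varSupport, hu])
    have hj : region s t σ y j = region s t σ y' j :=
      region_congr fun u hu => h u (by simp [varSupport, hu])
    have hk : region s t σ y k = region s t σ y' k :=
      region_congr fun u hu => h u (by simp [varSupport, hu])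
    have hy (hk : k ≠ s ∧ k ≠ t) : y ⟨k, hk⟩ = y' ⟨k, hk⟩ := h _ (by simp [varSupport])
    simp only [gather, gatherZ, gatherX, Sum.elim_inr, hi, hj, hk, hy]

theorem eq_zero_of_ne_one_F2 {a : F2} (h : a ≠ 1) : a = 0 := by
  revert a; decide

theorem gatherX_zero (hσ : WOrderProper σ) (hst : s ≠ t) (hx : σ (xvar s t) = 1)
    (i j : Fin n) : gatherX s t σ 0 i j = σ (xvar i j) := by
  obtain ⟨hanti, htot, htrans, -⟩ := hσ
  have key (i j : Fin n) (h : region s t σ 0 i < region s t σ 0 j) : σ (xvar i j) = 1 := by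
    simp only [region, Pi.zero_apply, zero_ne_one, if_false] at h
    grind
  unfold gatherX
  split_ifs with h₁ h₂
  · exact (key i j h₁).symm
  · have hne : i ≠ j := by rintro rfl; exact h₁ h₂
    exact (eq_zero_of_ne_one_F2 fun h => hanti i j hne ⟨h, key j i h₂⟩).symm
  · rfl

theorem gather_zero (hσ : WOrderProper σ) (hst : s ≠ t) (hD : ¬ DensitySat s t σ) :
    gather s t σ 0 = σ := by
  simp only [DensitySat, not_or, not_exists, not_and] at hD
  have hx : σ (xvar s t) = 1 := by
    by_contra h; exact hD.1 (eq_zero_of_ne_one_F2 h)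
  funext v
  rcases v with ⟨i, j⟩ | ⟨i, k, j⟩
  · exact gatherX_zero hσ hst hx i j
  · change gatherZ s t σ 0 i k j = σ (zvar i k j)
    unfold gatherZ
    split_ifs with h₁ h₂
    · obtain ⟨hk, rfl, rfl⟩ := h₁
      exact (eq_zero_of_ne_one_F2 (hD.2 k hk.1 hk.2)).symm
    · simp only [gatherX_zero hσ hst hx] at h₂
      obtain ⟨⟨h₃, h₄, h₅⟩, h₆⟩ := h₂
      exact (eq_zero_of_ne_one_F2 fun h => h₆ (hσ.2.2.2 i k j h₃ h₄ h₅ h)).symm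
    · rfl

theorem gatherX_eq_one_iff (y : {k : Fin n // k ≠ s ∧ k ≠ t} → F2) (i j : Fin n) :
    gatherX s t σ y i j = 1 ↔ region s t σ y i < region s t σ y j ∨
      region s t σ y i = region s t σ y j ∧ σ (xvar i j) = 1 := by
  unfold gatherX
  split_ifs with h₁ h₂
  · simp [h₁]
  · simp [h₁, h₂.ne']
  · simp [le_antisymm (not_lt.mp h₂) (not_lt.mp h₁)]

theorem region_left (y : {k : Fin n // k ≠ s ∧ k ≠ t} → F2) : region s t σ y s = 1 := by
  simp [region]

theorem region_right (hst : s ≠ t) (y : {k : Fin n // k ≠ s ∧ k ≠ t} → F2) :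
    region s t σ y t = 3 := by
  simp [region, hst.symm]

theorem wOrderProper_gather (hσ : WOrderProper σ) (hst : s ≠ t)
    (y : {k : Fin n // k ≠ s ∧ k ≠ t} → F2) : WOrderProper (gather s t σ y) := by
  obtain ⟨hanti, htot, htrans, -⟩ := hσ
  have hX (i j : Fin n) : gather s t σ y (xvar i j) = 1 ↔ region s t σ y i < region s t σ y j ∨
      region s t σ y i = region s t σ y j ∧ σ (xvar i j) = 1 := gatherX_eq_one_iff y i j
  refine ⟨fun i j hij => ?_, fun i j hij => ?_, fun i j k hij hjk hik => ?_,
    fun i k j hik hkj hij hz => ?_⟩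
  · have := hanti i j hij
    rw [hX, hX]
    grind
  · have := htot i j hij
    rw [hX, hX]
    grind
  · have := htrans i j k hij hjk hik
    rw [hX, hX, hX]
    grind
  · change gatherZ s t σ y i k j = 1 at hz
    unfold gatherZ at hz
    split_ifs at hz with h₁ h₂
    · obtain ⟨hk, rfl, rfl⟩ := h₁
      have hk2 : region i j σ y k = 2 := by simp [region, hk, hz]
      rw [hX, hX, region_left, region_right hst, hk2]
      norm_num
    · exact absurd hz zero_ne_one
    · by_contra h
      exact h₂ ⟨⟨hik, hkj, hij⟩, h⟩

theorem densitySat_gather {y : {k : Fin n // k ≠ s ∧ k ≠ t} → F2} (hy : y ≠ 0) :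
    DensitySat s t (gather s t σ y) := by
  obtain ⟨⟨k, hk⟩, hyk⟩ := Function.ne_iff.mp hy
  refine Or.inr ⟨k, hk.1, hk.2, ?_⟩
  change gatherZ s t σ y s k t = 1
  rw [gatherZ, dif_pos ⟨hk, rfl, rfl⟩]
  by_contra h
  exact hyk (eq_zero_of_ne_one_F2 h)

end Gather

/-- For `n ≥ 3`, `DLO_n` is `⌊(n-3)/3⌋`-extensible w.r.t. `WORDER_n`:
every linear system with fewer than `⌊(n-3)/3⌋` equations having a WORDER-proper solution
has, for each density clause `D_{st}`, a WORDER-proper solution satisfying `D_{st}`. -/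
theorem dlo_extensible (n : ℕ) (hn : 3 ≤ n)
    (S : LinSystem (DLOVar n)) (hcard : S.card < (n - 3) / 3)
    (hsol : ∃ σ, SysSat σ S ∧ WOrderProper σ) (s t : Fin n) (hst : s ≠ t) :
    ∃ τ, SysSat τ S ∧ WOrderProper τ ∧ DensitySat s t τ := by 
  obtain ⟨σ, hS, hσ⟩ := hsol
  by_cases hD : DensitySat s t σ
  · exact ⟨σ, hS, hσ, hD⟩
  have hκ : Fintype.card {k : Fin n // k ≠ s ∧ k ≠ t} = n - 2 := by
    have h : (univ.filter fun k : Fin n => k ≠ s ∧ k ≠ t) = univ \ {s, t} := by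
      ext k; simp
    rw [Fintype.card_subtype, h, card_univ_sdiff, card_pair hst, Fintype.card_fin]
  obtain ⟨y, hy, hyS⟩ := exists_ne_zero_sysSat 3 (gather s t σ)
    (fun v => (varSupport v).subtype fun k => k ≠ s ∧ k ≠ t)
    (fun v => by
      rw [card_subtype]
      exact (card_filter_le _ _).trans (card_varSupport_le v))
    (fun v y y' h => gather_congr v fun u hu => h u (mem_subtype.mpr hu))
    S (by omega) (by rwa [gather_zero hσ hst hD])
  exact ⟨gather s t σ y, hyS, wOrderProper_gather hσ hst y, densitySat_gather hy⟩
end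

section
/- Let φ be an unsatisfiable linear r-CNF formula and let k ≥ r. If φ has no Res(⊕) refutation of width at most k, then there exists a k-winning strategy for φ. -/
open Finset

variable {V : Type}

/-- Width-bounded Res(⊕) derivability: `ResLinW φ w C` holds if `C` has a Res(⊕)
derivation from the clauses of `φ` in which every clause has width at most `w`. -/
inductive ResLinW [Fintype V] [DecidableEq V] (φ : LinCNF V) (w : ℕ) : LinClause V → Prop
  | ax {C : LinClause V} (hC : C ∈ φ) (hw : C.card ≤ w) : ResLinW φ w C
  | res {A B : LinClause V} {f : LinForm V}
      (h₁ : ResLinW φ w (insert (f, (0 : F2)) A)) (h₂ : ResLinW φ w (insert (f, (1 : F2)) B))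
      (hw : (A ∪ B).card ≤ w) : ResLinW φ w (A ∪ B)
  | weak {C D : LinClause V} (h : ResLinW φ w C)
      (himp : ∀ σ, ClauseSat σ C → ClauseSat σ D) (hw : D.card ≤ w) : ResLinW φ w D

/-- `φ` has a Res(⊕) refutation of width at most `w`. -/
def WidthLE [Fintype V] [DecidableEq V] (φ : LinCNF V) (w : ℕ) : Prop :=
  ResLinW φ w (∅ : LinClause V)

/-- A `k`-winning strategy for the linear CNF `φ`: a nonempty family `H` of linear systems
such that (1) each member has at most `k` equations; (2) each member has, for every clause
`C` of `φ`, a solution satisfying `C`; (3) `H` is closed under semantically implied systems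
with at most `k` equations; (4) each member with fewer than `k` equations can be extended
by `f = a` for some `a ∈ F2` while remaining in `H`. -/
def IsWinningStrategy [Fintype V] [DecidableEq V] (φ : LinCNF V) (k : ℕ)
    (H : Set (LinSystem V)) : Prop :=
  H.Nonempty ∧
  (∀ F ∈ H, F.card ≤ k) ∧
  (∀ F ∈ H, ∀ C ∈ φ, ∃ σ, SysSat σ F ∧ ClauseSat σ C) ∧
  (∀ F ∈ H, ∀ G : LinSystem V, G.card ≤ k → (∀ σ, SysSat σ F → SysSat σ G) → G ∈ H) ∧
  (∀ F ∈ H, F.card < k → ∀ f : LinForm V, ∃ a : F2, insert ((f, a) : LinLit V) F ∈ H)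

/-- The clause negating a linear system: every equation `f = a` becomes `f = a + 1`. -/
def negSystem [Fintype V] [DecidableEq V] (S : LinSystem V) : LinClause V :=
  S.image fun l => (l.1, l.2 + 1)

theorem card_negSystem_le [Fintype V] [DecidableEq V] (S : LinSystem V) :
    (negSystem S).card ≤ S.card :=
  Finset.card_image_le

theorem F2.eq_add_one_iff_ne : ∀ x a : F2, x = a + 1 ↔ x ≠ a := by decide

theorem clauseSat_negSystem [Fintype V] [DecidableEq V] (σ : V → F2) (S : LinSystem V) :
    ClauseSat σ (negSystem S) ↔ ¬ SysSat σ S := by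
  simp only [ClauseSat, SysSat, negSystem, LitSat, Finset.exists_mem_image,
    F2.eq_add_one_iff_ne, not_forall, exists_prop, ne_eq]

theorem negSystem_insert [Fintype V] [DecidableEq V] (f : LinForm V) (a : F2) (S : LinSystem V) :
    negSystem (insert ((f, a) : LinLit V) S) = insert (f, a + 1) (negSystem S) :=
  Finset.image_insert _ _ _

/-- If an unsatisfiable linear `r`-CNF `φ` has no Res(⊕) refutation of
width at most `k`, where `k ≥ r`, then there exists a `k`-winning strategy for `φ`. -/
theorem winning_strategy_of_no_small_width_refutation
    {V : Type} [Fintype V] [DecidableEq V] (φ : LinCNF V) (r k : ℕ)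
    (hunsat : Unsat φ) (hr : ∀ C ∈ φ, C.card ≤ r) (hk : r ≤ k)
    (hwidth : ¬ WidthLE φ k) :
    ∃ H : Set (LinSystem V), IsWinningStrategy φ k H := by
  refine ⟨{F | F.card ≤ k ∧ ¬ ResLinW φ k (negSystem F)}, ⟨∅, by simp, hwidth⟩,
    fun F hF => hF.1, ?_, ?_, ?_⟩
  · rintro F ⟨hcard, hF⟩ C hC
    by_contra! h
    refine hF (.weak (.ax hC ((hr C hC).trans hk)) (fun σ hσ => ?_)
      ((card_negSystem_le F).trans hcard))
    exact (clauseSat_negSystem σ F).2 fun hs => h σ hs hσ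
  · rintro F ⟨hcard, hF⟩ G hGcard hFG
    refine ⟨hGcard, fun hG => hF (.weak hG (fun σ hσ => ?_)
      ((card_negSystem_le F).trans hcard))⟩
    rw [clauseSat_negSystem] at hσ ⊢
    exact fun hs => hσ (hFG σ hs)
  · rintro F ⟨hcard, hF⟩ hlt f
    by_contra! h
    have derivable (a : F2) : ResLinW φ k (insert (f, a + 1) (negSystem F)) := by
      by_contra ha
      exact h a ⟨(Finset.card_insert_le _ _).trans hlt, by rwa [negSystem_insert]⟩
    have hres := ResLinW.res (derivable 1) (derivable 0)
      (by rw [Finset.union_self]; exact (card_negSystem_le F).trans hcard)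
    rw [Finset.union_self] at hres
    exact hF hres
end

section
/- If a linear CNF formula φ has a (k+1)-winning strategy, then φ has no Res(⊕) refutation of width at most k. -/
open Finset

variable {V : Type}

/-- The linear system expressing that every literal of the clause `C` fails. -/
def negClause [Fintype V] [DecidableEq V] (C : LinClause V) : LinSystem V :=
  C.image fun l => (l.1, l.2 + 1)

theorem card_negClause_le [Fintype V] [DecidableEq V] (C : LinClause V) :
    (negClause C).card ≤ C.card :=
  Finset.card_image_le

theorem litSat_add_one_iff [Fintype V] (σ : V → F2) (f : LinForm V) (a : F2) :
    LitSat σ (f, a + 1) ↔ ¬ LitSat σ (f, a) := by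
  have key : ∀ x y : F2, x = y + 1 ↔ ¬ x = y := by decide
  exact key _ _

theorem sysSat_negClause_iff [Fintype V] [DecidableEq V] (σ : V → F2) (C : LinClause V) :
    SysSat σ (negClause C) ↔ ¬ ClauseSat σ C := by
  simp only [SysSat, negClause, ClauseSat, Finset.forall_mem_image, litSat_add_one_iff,
    not_exists, not_and]

theorem ResLinW.card_le [Fintype V] [DecidableEq V] {φ : LinCNF V} {w : ℕ} {C : LinClause V}
    (h : ResLinW φ w C) : C.card ≤ w := by
  cases h <;> assumption

/-- If `H` is a `(k+1)`-winning strategy, then no clause derivable in width `k` is refuted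
by a system of `H`. -/
theorem IsWinningStrategy.negClause_notMem [Fintype V] [DecidableEq V] {φ : LinCNF V} {k : ℕ}
    {H : Set (LinSystem V)} (hH : IsWinningStrategy φ (k + 1) H) {C : LinClause V}
    (hC : ResLinW φ k C) : negClause C ∉ H := by
  obtain ⟨-, -, hsat, hclosed, hext⟩ := hH
  have descend : ∀ {F : LinSystem V} {D : LinClause V}, F ∈ H → ResLinW φ k D →
      (∀ σ, SysSat σ F → ¬ ClauseSat σ D) → negClause D ∈ H := fun hF hD himp =>
    hclosed _ hF _ (((card_negClause_le _).trans hD.card_le).trans k.le_succ)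
      fun σ hσ => (sysSat_negClause_iff σ _).2 (himp σ hσ)
  induction hC with
  | ax hC _ =>
    intro hmem
    obtain ⟨σ, hσ, hσC⟩ := hsat _ hmem _ hC
    exact (sysSat_negClause_iff σ _).1 hσ hσC
  | weak h himp _ ih =>
    exact fun hmem => ih <| descend hmem h fun σ hσ hσC =>
      (sysSat_negClause_iff σ _).1 hσ (himp σ hσC)
  | @res A B f h₁ h₂ hw ih₁ ih₂ =>
    intro hmem
    obtain ⟨a, ha⟩ := hext _ hmem (Nat.lt_succ_of_le ((card_negClause_le _).trans hw)) f
    have fails : ∀ {b : F2} {D : LinClause V}, D ⊆ A ∪ B → b ≠ a → ∀ σ,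
        SysSat σ (insert (f, a) (negClause (A ∪ B))) → ¬ ClauseSat σ (insert (f, b) D) := by
      rintro b D hD hb σ hσ ⟨l, hl, hσl⟩
      rcases Finset.mem_insert.1 hl with rfl | hl
      · exact hb (hσl.symm.trans (hσ _ (Finset.mem_insert_self _ _)))
      · exact (sysSat_negClause_iff σ _).1 (fun m hm => hσ m (Finset.mem_insert_of_mem hm))
          ⟨l, hD hl, hσl⟩
    by_cases h0 : a = 0
    · exact ih₂ (descend ha h₂ (fails Finset.subset_union_right (by simp [h0])))
    · exact ih₁ (descend ha h₁ (fails Finset.subset_union_left (Ne.symm h0)))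

/-- If a linear CNF `φ` has a `(k+1)`-winning strategy, then `φ` has no
Res(⊕) refutation of width at most `k`. -/
theorem no_small_width_refutation_of_winning_strategy
    {V : Type} [Fintype V] [DecidableEq V] (φ : LinCNF V) (k : ℕ)
    (H : Set (LinSystem V)) (hH : IsWinningStrategy φ (k + 1) H) :
    ¬ WidthLE φ k := by
  intro href
  obtain ⟨F, hF⟩ := hH.1
  exact hH.negClause_notMem href
    (hH.2.2.2.1 F hF _ (Nat.zero_le _) fun σ _ => by simp [SysSat, negClause])
end
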